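/- Let Ch = (Ch_c)_{c∈C} be a profile of college choice functions such that under every Ch_c contracts are observable substitutes for monotone preferences and the observable law of aggregate demand for monotone preferences holds. Then Ch is DA-stable and Ch is DA-equivalent to a choice profile Ch' under which contracts are substitutes for every college and every college's choice function satisfies the law of aggregate demand; moreover, each Ch'_c can be chosen monotone in contract terms and constructed from Ch_c alone (independently of Ch_{-c}). -/

import Mathlib

open scoped Classical

namespace MWC

variable {C S T : Type*} [DecidableEq C] [DecidableEq S] [DecidableEq T] [LinearOrder T]

/-! Contracts are triples `(college, student, term)`.  For `x : C × S × T`,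
`x.1` is the college, `x.2.1` the student and `x.2.2` the contract term.
The linear order on `T` plays the role of `▷`: higher terms are better for students. -/

variable (X : Finset (C × S × T))

/-- The contracts in `X` naming college `c` (the set `X_c`). -/
def Xc (c : C) : Finset (C × S × T) := X.filter fun x => x.1 = c

/-- A set of contracts containing at most one contract per student. -/
def IsAlloc (Y : Finset (C × S × T)) : Prop :=
  ∀ x ∈ Y, ∀ y ∈ Y, x.2.1 = y.2.1 → x = y

/-- `Ch` is a valid choice function for college `c`: from each subset of `X_c` it
chooses a subset with at most one contract per student, and it satisfies the
irrelevance of rejected contracts (IRC). -/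
def IsChoice (c : C) (Ch : Finset (C × S × T) → Finset (C × S × T)) : Prop :=
  (∀ Y, Y ⊆ Xc X c → Ch Y ⊆ Y) ∧
  (∀ Y, Y ⊆ Xc X c → IsAlloc (Ch Y)) ∧
  (∀ Y, Y ⊆ Xc X c → ∀ x ∈ Xc X c, x ∉ Y → x ∉ Ch (insert x Y) → Ch Y = Ch (insert x Y))

/-- The rejection function `R_c(Y) = Y \ Ch_c(Y)`. -/
def Rej (Ch : Finset (C × S × T) → Finset (C × S × T)) (Y : Finset (C × S × T)) :
    Finset (C × S × T) := Y \ Ch Y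

/-- Contracts are substitutes under `Ch` (for college `c`). -/
def Substitutes (c : C) (Ch : Finset (C × S × T) → Finset (C × S × T)) : Prop :=
  ∀ Y, Y ⊆ Xc X c → ∀ x ∈ Xc X c, ∀ z ∈ Xc X c, x ∉ Y → z ∉ Y →
    x ∈ Ch (insert z (insert x Y)) → x ∈ Ch (insert x Y)

/-- The law of aggregate demand for `Ch` (college `c`). -/
def LAD (c : C) (Ch : Finset (C × S × T) → Finset (C × S × T)) : Prop :=
  ∀ Z Y, Z ⊆ Y → Y ⊆ Xc X c → (Ch Z).card ≤ (Ch Y).card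

/-- `Y^min`: the contracts of `Y` that give each involved student his
`▷`-worst contract among his contracts in `Y`. -/
def Ymin (Y : Finset (C × S × T)) : Finset (C × S × T) :=
  Y.filter fun y => ∀ y' ∈ Y, y'.2.1 = y.2.1 → ¬ y'.2.2 < y.2.2

/-- `Ch` is monotone in contract terms: it always chooses from `Y^min`. -/
def MonotoneCh (c : C) (Ch : Finset (C × S × T) → Finset (C × S × T)) : Prop :=
  ∀ Y, Y ⊆ Xc X c → Ch Y ⊆ Ymin Y

/-- `us` represents a strict preference of student `s` over his contracts in `X`
together with the outside option (utility `0`), monotone in contract terms: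
a higher contract term is always strictly better. -/
def IsPref (s : S) (us : C × S × T → ℤ) : Prop :=
  (∀ x ∈ X, x.2.1 = s → us x ≠ 0) ∧
  (∀ x ∈ X, ∀ y ∈ X, x.2.1 = s → y.2.1 = s → x ≠ y → us x ≠ us y) ∧
  (∀ x ∈ X, ∀ y ∈ X, x.2.1 = s → y.2.1 = s → y.2.2 < x.2.2 → us y < us x)

/-- The utility student `s` derives from allocation `Y` (`0` = outside option). -/
def util (us : C × S × T → ℤ) (s : S) (Y : Finset (C × S × T)) : ℤ :=
  ∑ x ∈ Y.filter (fun x => x.2.1 = s), us x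

/-- Individual rationality of allocation `Y` in the market `(Ch, u)`. -/
def IndivRat (Ch : C → Finset (C × S × T) → Finset (C × S × T))
    (u : S → C × S × T → ℤ) (Y : Finset (C × S × T)) : Prop :=
  (∀ c, Y.filter (fun x => x.1 = c) = Ch c (Y.filter fun x => x.1 = c)) ∧
  ∀ y ∈ Y, 0 < u y.2.1 y

/-- College `c` together with allocation `Z` blocks allocation `Y`. -/
def Blocks (Ch : C → Finset (C × S × T) → Finset (C × S × T))
    (u : S → C × S × T → ℤ) (c : C) (Z Y : Finset (C × S × T)) : Prop :=
  Z ⊆ X ∧ IsAlloc Z ∧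
  Z.filter (fun x => x.1 = c) ≠ Y.filter (fun x => x.1 = c) ∧
  Z.filter (fun x => x.1 = c) = Ch c ((Y ∪ Z).filter fun x => x.1 = c) ∧
  ∀ z ∈ Z.filter (fun x => x.1 = c), util (u z.2.1) z.2.1 Y ≤ u z.2.1 z

/-- Stability of allocation `Y` in the market `(Ch, u)`. -/
def Stable (Ch : C → Finset (C × S × T) → Finset (C × S × T))
    (u : S → C × S × T → ℤ) (Y : Finset (C × S × T)) : Prop :=
  Y ⊆ X ∧ IsAlloc Y ∧ IndivRat Ch u Y ∧ ¬ ∃ c Z, Blocks X Ch u c Z Y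

/-- The contracts proposed when `D` is the set of contracts rejected so far:
every student proposes his most preferred acceptable not-yet-rejected contract. -/
def proposals (u : S → C × S × T → ℤ) (D : Finset (C × S × T)) : Finset (C × S × T) :=
  (X \ D).filter fun x =>
    0 < u x.2.1 x ∧ ∀ y ∈ X \ D, y.2.1 = x.2.1 → u x.2.1 y ≤ u x.2.1 x

/-- The contracts tentatively held by the colleges among the proposals `P`:
each college `c` keeps its choice from the contracts proposed to it. -/
def held (Ch : C → Finset (C × S × T) → Finset (C × S × T))
    (P : Finset (C × S × T)) : Finset (C × S × T) :=
  P.filter fun x => x ∈ Ch x.1 (P.filter fun y => y.1 = x.1)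

/-- One round of the student-proposing deferred acceptance algorithm, acting on the
cumulative set of rejected contracts. -/
def step (Ch : C → Finset (C × S × T) → Finset (C × S × T))
    (u : S → C × S × T → ℤ) (D : Finset (C × S × T)) : Finset (C × S × T) :=
  D ∪ (proposals X u D \ held Ch (proposals X u D))

/-- The outcome `DA(Ch, u)` of the student-proposing deferred acceptance algorithm
(the algorithm reaches a fixed point after at most `|X| + 1` rounds). -/
def DA (Ch : C → Finset (C × S × T) → Finset (C × S × T))
    (u : S → C × S × T → ℤ) : Finset (C × S × T) :=
  held Ch (proposals X u ((step X Ch u)^[X.card + 1] ∅))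

/-- The cumulative set of contracts proposed up to round `t` of the deferred
acceptance algorithm. -/
def cumProposed (Ch : C → Finset (C × S × T) → Finset (C × S × T))
    (u : S → C × S × T → ℤ) (t : ℕ) : Finset (C × S × T) :=
  (Finset.range (t + 1)).biUnion fun r => proposals X u ((step X Ch u)^[r] ∅)

/-- Two choice profiles are deferred-acceptance-equivalent if the DA algorithm
produces the same outcome under both, for every profile of strict preferences
monotone in contract terms. -/
def DAeq (Ch Ch' : C → Finset (C × S × T) → Finset (C × S × T)) : Prop :=
  ∀ u : S → C × S × T → ℤ, (∀ s, IsPref X s (u s)) → DA X Ch u = DA X Ch' u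

/-- `Ch` is DA-stable: the DA outcome is stable for every profile of strict
preferences monotone in contract terms. -/
def DAStable (Ch : C → Finset (C × S × T) → Finset (C × S × T)) : Prop :=
  ∀ u : S → C × S × T → ℤ, (∀ s, IsPref X s (u s)) → Stable X Ch u (DA X Ch u)

/-- Mechanism `M` is `Ch`-stable. -/
def StableMech (Ch : C → Finset (C × S × T) → Finset (C × S × T))
    (M : (S → C × S × T → ℤ) → Finset (C × S × T)) : Prop :=
  ∀ u : S → C × S × T → ℤ, (∀ s, IsPref X s (u s)) → Stable X Ch u (M u)

/-- Strategy-proofness of a mechanism on the domain of strict preferences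
monotone in contract terms. -/
def SP (M : (S → C × S × T → ℤ) → Finset (C × S × T)) : Prop :=
  ∀ u u' : S → C × S × T → ℤ, (∀ s, IsPref X s (u s)) → (∀ s, IsPref X s (u' s)) →
    ∀ s : S, (∀ s', s' ≠ s → u' s' = u s') →
      util (u s) s (M u') ≤ util (u s) s (M u)

/-- Group-strategy-proofness of a mechanism on the domain of strict preferences
monotone in contract terms. -/
def GSP (M : (S → C × S × T → ℤ) → Finset (C × S × T)) : Prop :=
  ∀ u u' : S → C × S × T → ℤ, (∀ s, IsPref X s (u s)) → (∀ s, IsPref X s (u' s)) →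
    ∀ S' : Set S, S'.Nonempty → (∀ s, s ∉ S' → u' s = u s) →
      ∃ s' ∈ S', util (u s') s' (M u') ≤ util (u s') s' (M u)

/-- The sequence `L` consists of contracts in `X_c`. -/
def SeqIn (c : C) (L : List (C × S × T)) : Prop := ∀ x ∈ L, x ∈ Xc X c

/-- The sequence `L` is generated from monotone preferences: every contract (of the
relevant college) with the same student and a strictly higher term than the `t`-th
element appears among the first `t` elements. -/
def GenMono (c : C) (L : List (C × S × T)) : Prop :=
  ∀ (t : ℕ) (ht : t < L.length), ∀ x ∈ Xc X c, x.2.1 = (L.get ⟨t, ht⟩).2.1 →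
    (L.get ⟨t, ht⟩).2.2 < x.2.2 → x ∈ L.take t

/-- The sequence `L` is observable under `Ch`: the student of each next contract is
not among the students currently chosen by `Ch`. -/
def ObsSeq (Ch : Finset (C × S × T) → Finset (C × S × T)) (L : List (C × S × T)) : Prop :=
  ∀ (t : ℕ) (ht : t < L.length), 0 < t →
    (L.get ⟨t, ht⟩).2.1 ∉ (Ch (L.take t).toFinset).image fun y => y.2.1

/-- Observable substitutability for monotone preferences. -/
def ObsSub (c : C) (Ch : Finset (C × S × T) → Finset (C × S × T)) : Prop :=
  ∀ L : List (C × S × T), SeqIn X c L → GenMono X c L → ObsSeq Ch L →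
    ∀ t : ℕ, t + 1 ≤ L.length →
      Rej Ch (L.take t).toFinset ⊆ Rej Ch (L.take (t + 1)).toFinset

/-- The observable law of aggregate demand for monotone preferences. -/
def ObsLAD (c : C) (Ch : Finset (C × S × T) → Finset (C × S × T)) : Prop :=
  ∀ L : List (C × S × T), SeqIn X c L → GenMono X c L → ObsSeq Ch L →
    ∀ t : ℕ, t + 1 ≤ L.length →
      (Ch (L.take t).toFinset).card ≤ (Ch (L.take (t + 1)).toFinset).card

/-- `Y` is an observable set under `Ch`. -/
def ObsSet (c : C) (Ch : Finset (C × S × T) → Finset (C × S × T))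
    (Y : Finset (C × S × T)) : Prop :=
  ∃ L : List (C × S × T), L.Nodup ∧ L.toFinset = Y ∧ SeqIn X c L ∧
    GenMono X c L ∧ ObsSeq Ch L

/-- `Ytil` is a maximal observable subset of `Y` under `Ch`. -/
def MaxObsSubset (c : C) (Ch : Finset (C × S × T) → Finset (C × S × T))
    (Y Ytil : Finset (C × S × T)) : Prop :=
  Ytil ⊆ Y ∧ ObsSet X c Ch Ytil ∧
    ∀ Y', ObsSet X c Ch Y' → Ytil ⊆ Y' → Y' ⊆ Y → Y' = Ytil

/-- `U(Y)`: the contracts in `X_c` that are at least as good for the involved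
student as some contract of his in `Y`. -/
def Uset (c : C) (Y : Finset (C × S × T)) : Finset (C × S × T) :=
  (Xc X c).filter fun x => ∃ y ∈ Y, x.2.1 = y.2.1 ∧ (y.2.2 < x.2.2 ∨ x = y)

/-- `Y^∨`: the (under observable substitutability unique) maximal observable subset
of `U(Y)` under `Ch`. -/
noncomputable def vee (c : C) (Ch : Finset (C × S × T) → Finset (C × S × T))
    (Y : Finset (C × S × T)) : Finset (C × S × T) :=
  if h : ∃ V, MaxObsSubset X c Ch (Uset X c Y) V then h.choose else ∅

/-- The virtual choice function
`Ch'_c(Y) = { x ∈ Y^min : x_S ∈ [Ch_c(Y^∨)]_S }`. -/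
noncomputable def virtualChoice (c : C) (Ch : Finset (C × S × T) → Finset (C × S × T))
    (Y : Finset (C × S × T)) : Finset (C × S × T) :=
  (Ymin Y).filter fun x => x.2.1 ∈ (Ch (vee X c Ch Y)).image fun y => y.2.1

section helpers

/-! ### Helper material -/

/-- One observable step: `W` arises from `V` by adding one contract. -/
def ostep (c : C) (Ch : Finset (C × S × T) → Finset (C × S × T))
    (V W : Finset (C × S × T)) : Prop :=
  ∃ x ∈ Xc X c, x ∉ V ∧ (∀ y ∈ Xc X c, y.2.1 = x.2.1 → x.2.2 < y.2.2 → y ∈ V) ∧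
    (∀ y ∈ Ch V, y.2.1 ≠ x.2.1) ∧ W = insert x V

/-- Reachability by observable steps. -/
def oreach (c : C) (Ch : Finset (C × S × T) → Finset (C × S × T))
    (V W : Finset (C × S × T)) : Prop := Relation.ReflTransGen (ostep X c Ch) V W

/-- Observable sets, inductively. -/
def obs (c : C) (Ch : Finset (C × S × T) → Finset (C × S × T))
    (V : Finset (C × S × T)) : Prop := oreach X c Ch ∅ V

/-- Good: choice function with observable monotonicity. -/
def good (c : C) (Ch : Finset (C × S × T) → Finset (C × S × T)) : Prop :=
  ∀ V W, obs X c Ch V → ostep X c Ch V W →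
    Rej Ch V ⊆ Rej Ch W ∧ (Ch V).card ≤ (Ch W).card

variable {X} {c : C} {Ch : Finset (C × S × T) → Finset (C × S × T)}

theorem mem_Xc {x : C × S × T} : x ∈ Xc X c ↔ x ∈ X ∧ x.1 = c := by
  simp [Xc]

theorem Ch_empty (h : IsChoice X c Ch) : Ch ∅ = ∅ :=
  Finset.subset_empty.mp (h.1 ∅ (Finset.empty_subset _))

theorem obs_sub {V : Finset (C × S × T)} (h : obs X c Ch V) : V ⊆ Xc X c := by
  induction h with
  | refl => exact Finset.empty_subset _
  | tail _ h ih =>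
    obtain ⟨x, hx, _, _, _, rfl⟩ := h
    exact Finset.insert_subset hx ih

theorem list_of_obs (V : Finset (C × S × T)) (h : obs X c Ch V) :
    ObsSet X c Ch V := by
  induction h with
  | refl => exact ⟨[], by simp, by simp, by simp [SeqIn], by simp [GenMono], by simp [ObsSeq]⟩
  | @tail V W _ h ih =>
    obtain ⟨x, hx, hxV, hup, hst, rfl⟩ := h
    obtain ⟨L, hnd, hL, hin, hgen, hobs⟩ := ih
    refine ⟨L ++ [x], ?_, ?_, ?_, ?_, ?_⟩
    · rw [List.nodup_append]
      refine ⟨hnd, by simp, ?_⟩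
      intro a ha b hb hab
      simp only [List.mem_singleton] at hb
      subst hb; subst hab
      exact hxV (hL ▸ List.mem_toFinset.mpr ha)
    · rw [List.toFinset_append, hL]; ext y; simp [or_comm]
    · intro y hy
      rcases List.mem_append.mp hy with h | h
      · exact hin y h
      · simp only [List.mem_singleton] at h; exact h ▸ hx
    · intro t ht y hy
      rcases lt_or_ge t L.length with h | h
      · have := hgen t h y hy
        simpa [List.getElem_append, h, List.take_append_of_le_length h.le] using this
      · have : t = L.length := by simp at ht; omega
        subst this
        simp
        intro h1 h2
        have := hup y hy h1 h2
        rwa [← hL, List.mem_toFinset] at this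
    · intro t ht h0
      rcases lt_or_ge t L.length with h | h
      · have := hobs t h h0
        simpa [List.getElem_append, h, List.take_append_of_le_length h.le] using this
      · have : t = L.length := by simp at ht; omega
        subst this
        simp only [Finset.mem_image, not_exists, not_and]
        intro y hy
        have : y ∈ Ch V := by simpa [hL] using hy
        simpa using hst y this

theorem obs_of_list (hCh : IsChoice X c Ch) (L : List (C × S × T)) :
    L.Nodup → SeqIn X c L → GenMono X c L → ObsSeq Ch L → obs X c Ch L.toFinset := by
  induction L using List.reverseRecOn with
  | nil => intro _ _ _ _; exact Relation.ReflTransGen.refl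
  | append_singleton L x ih =>
    intro hnd hin hgen hobs
    rw [List.nodup_append] at hnd
    have h1 : obs X c Ch L.toFinset := by
      refine ih hnd.1 (fun y hy => hin y (by simp [hy])) ?_ ?_
      · intro t h y hy
        have := hgen t (by simp; omega) y hy
        simpa [List.getElem_append, h, List.take_append_of_le_length h.le] using this
      · intro t h h0
        have := hobs t (by simp; omega) h0
        simpa [List.getElem_append, h, List.take_append_of_le_length h.le] using this
    refine Relation.ReflTransGen.tail h1 ⟨x, hin x (by simp), ?_, ?_, ?_, ?_⟩
    · intro h; exact hnd.2.2 x (List.mem_toFinset.mp h) x (by simp) rfl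
    · intro y hy h2 h3
      have := hgen L.length (by simp) y hy (by simpa using h2) (by simpa using h3)
      simpa using this
    · intro y hy h2
      rcases Nat.eq_zero_or_pos L.length with h | h
      · have : L = [] := List.length_eq_zero_iff.mp h
        subst this
        rw [List.toFinset_nil, Ch_empty hCh] at hy
        simp at hy
      · apply hobs L.length (by simp) h
        rw [Finset.mem_image]
        exact ⟨y, by simpa using hy, by simpa using h2⟩
    · rw [List.toFinset_append]; ext y; simp [or_comm]

theorem obsSet_iff (hCh : IsChoice X c Ch) (V : Finset (C × S × T)) :
    ObsSet X c Ch V ↔ obs X c Ch V := by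
  constructor
  · rintro ⟨L, h1, rfl, h2, h3, h4⟩
    exact obs_of_list hCh L h1 h2 h3 h4
  · exact list_of_obs V

theorem good_of (h1 : ObsSub X c Ch) (h2 : ObsLAD X c Ch) : good X c Ch := by
  intro V W hV hVW
  have hW : obs X c Ch W := Relation.ReflTransGen.tail hV hVW
  obtain ⟨x, hx, hxV, hup, hst, rfl⟩ := hVW
  obtain ⟨L, hnd, hL, hin, hgen, hobs⟩ := list_of_obs V hV
  have key : SeqIn X c (L ++ [x]) ∧ GenMono X c (L ++ [x]) ∧ ObsSeq Ch (L ++ [x]) := by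
    refine ⟨?_, ?_, ?_⟩
    · intro y hy
      rcases List.mem_append.mp hy with h | h
      · exact hin y h
      · simp only [List.mem_singleton] at h; exact h ▸ hx
    · intro t ht y hy
      rcases lt_or_ge t L.length with h | h
      · have := hgen t h y hy
        simpa [List.getElem_append, h, List.take_append_of_le_length h.le] using this
      · have : t = L.length := by simp at ht; omega
        subst this
        simp
        intro h1 h2
        have := hup y hy h1 h2
        rwa [← hL, List.mem_toFinset] at this
    · intro t ht h0
      rcases lt_or_ge t L.length with h | h
      · have := hobs t h h0
        simpa [List.getElem_append, h, List.take_append_of_le_length h.le] using this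
      · have : t = L.length := by simp at ht; omega
        subst this
        simp only [Finset.mem_image, not_exists, not_and]
        intro y hy
        have : y ∈ Ch V := by simpa [hL] using hy
        simpa using hst y this
  have e1 : ((L ++ [x]).take L.length).toFinset = V := by simpa using hL
  have e2 : ((L ++ [x]).take (L.length + 1)).toFinset = insert x V := by
    rw [List.take_of_length_le (by simp), List.toFinset_append, hL]; ext y; simp [or_comm]
  have a := h1 _ key.1 key.2.1 key.2.2 L.length (by simp)
  have b := h2 _ key.1 key.2.1 key.2.2 L.length (by simp)
  rw [e1, e2] at a b
  exact ⟨a, b⟩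

theorem eq_of_term {x y : C × S × T} (hx : x ∈ Xc X c) (hy : y ∈ Xc X c)
    (hs : x.2.1 = y.2.1) (ht : x.2.2 = y.2.2) : x = y := by
  have h1 := (mem_Xc.mp hx).2
  have h2 := (mem_Xc.mp hy).2
  exact Prod.ext (h1.trans h2.symm) (Prod.ext hs ht)

/-- Observable steps can be postponed along reachability. -/
theorem oreach_insert (hg : good X c Ch) (hCh : IsChoice X c Ch)
    {A W : Finset (C × S × T)} (hA : obs X c Ch A) (h : oreach X c Ch A W)
    {x : C × S × T} (hx : ostep X c Ch A (insert x A)) (hxA : x ∉ A) :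
    oreach X c Ch (insert x A) (insert x W) ∧
      (x ∈ W ∨ ostep X c Ch W (insert x W)) := by
  induction h with
  | refl => exact ⟨Relation.ReflTransGen.refl, Or.inr hx⟩
  | @tail V W hAV hVW ih =>
    obtain ⟨ih1, ih2⟩ := ih
    have hV : obs X c Ch V := Relation.ReflTransGen.trans hA hAV
    have hW : obs X c Ch W := Relation.ReflTransGen.tail hV hVW
    have hWc := obs_sub hW
    have hRW := (hg V W hV hVW).1
    have hVW' := hVW
    obtain ⟨w, hw, hwV, hup, hst, rfl⟩ := hVW
    rcases ih2 with hxV | hxs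
    · rw [Finset.insert_eq_of_mem hxV] at ih1
      have hxW : x ∈ insert w V := Finset.mem_insert_of_mem hxV
      refine ⟨?_, Or.inl hxW⟩
      rw [Finset.insert_eq_of_mem hxW]
      exact Relation.ReflTransGen.tail ih1 hVW'
    · by_cases hxV : x ∈ V
      · rw [Finset.insert_eq_of_mem hxV] at ih1
        have hxW : x ∈ insert w V := Finset.mem_insert_of_mem hxV
        refine ⟨?_, Or.inl hxW⟩
        rw [Finset.insert_eq_of_mem hxW]
        exact Relation.ReflTransGen.tail ih1 hVW'
      by_cases hxw : x = w
      · subst hxw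
        refine ⟨?_, Or.inl (Finset.mem_insert_self _ _)⟩
        rw [Finset.insert_eq_of_mem (Finset.mem_insert_self _ _)]
        exact ih1
      have hRx := (hg V _ hV hxs).1
      obtain ⟨x', hx', hx'V, hup', hst', he⟩ := hxs
      have : x' = x := by
        have : x' ∈ insert x V := he ▸ Finset.mem_insert_self _ _
        rcases Finset.mem_insert.mp this with h | h
        · exact h
        · exact absurd h hx'V
      subst this
      have hne : x'.2.1 ≠ w.2.1 := by
        intro hs
        rcases lt_trichotomy x'.2.2 w.2.2 with h | h | h
        · exact hwV (hup' w hw hs.symm h)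
        · exact hxw (eq_of_term hx' hw hs h)
        · exact hxV (hup x' hx' hs h)
      have aux : ∀ p q : C × S × T, p ∈ Xc X c → q.2.1 ≠ p.2.1 →
          Rej Ch V ⊆ Rej Ch (insert p V) → (∀ y ∈ Ch V, y.2.1 ≠ q.2.1) →
          ∀ y ∈ Ch (insert p V), y.2.1 ≠ q.2.1 := by
        intro p q hp hpq hR hq y hy hyq
        have hsub : insert p V ⊆ Xc X c := Finset.insert_subset hp (obs_sub hV)
        have h1 := hCh.1 _ hsub hy
        rcases Finset.mem_insert.mp h1 with h | h
        · subst h; exact hpq hyq.symm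
        · have : y ∈ Rej Ch V := by
            unfold Rej
            exact Finset.mem_sdiff.mpr ⟨h, fun h' => hq y h' hyq⟩
          have := hR this
          unfold Rej at this
          exact (Finset.mem_sdiff.mp this).2 hy
      refine ⟨Relation.ReflTransGen.tail ih1 ⟨w, hw, ?_, ?_, ?_, Finset.insert_comm _ _ _⟩,
        Or.inr ⟨x', hx', ?_, ?_, ?_, rfl⟩⟩
      · simp only [Finset.mem_insert, not_or]; exact ⟨fun h => hxw h.symm, hwV⟩
      · intro y hy h1 h2; exact Finset.mem_insert_of_mem (hup y hy h1 h2)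
      · exact aux x' w hx' hne.symm hRx hst
      · simp only [Finset.mem_insert, not_or]; exact ⟨hxw, hxV⟩
      · intro y hy h1 h2; exact Finset.mem_insert_of_mem (hup' y hy h1 h2)
      · exact aux w x' hw hne hRW hst'

theorem oreach_union (hg : good X c Ch) (hCh : IsChoice X c Ch)
    {V W : Finset (C × S × T)} (hV : obs X c Ch V) (hW : obs X c Ch W) :
    oreach X c Ch V (V ∪ W) ∧ oreach X c Ch W (V ∪ W) := by
  induction hV with
  | refl => simp only [Finset.empty_union]; exact ⟨hW, Relation.ReflTransGen.refl⟩
  | @tail V V' hV hVV ih =>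
    obtain ⟨ih1, ih2⟩ := ih
    have hVV' := hVV
    obtain ⟨x, hx, hxV, hup, hst, rfl⟩ := hVV
    obtain ⟨a, b⟩ := oreach_insert hg hCh hV ih1 hVV' hxV
    rw [Finset.insert_union]
    refine ⟨a, ?_⟩
    rcases b with h | h
    · rw [Finset.insert_eq_of_mem h]; exact ih2
    · exact Relation.ReflTransGen.tail ih2 h

theorem mono_reach (hg : good X c Ch) {V W : Finset (C × S × T)} (hV : obs X c Ch V)
    (h : oreach X c Ch V W) : Rej Ch V ⊆ Rej Ch W ∧ (Ch V).card ≤ (Ch W).card := by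
  induction h with
  | refl => exact ⟨Finset.Subset.refl _, le_rfl⟩
  | tail h1 h2 ih =>
    have := hg _ _ (Relation.ReflTransGen.trans hV h1) h2
    exact ⟨ih.1.trans this.1, ih.2.trans this.2⟩

theorem mono_obs (hg : good X c Ch) (hCh : IsChoice X c Ch)
    {V W : Finset (C × S × T)} (hV : obs X c Ch V) (hW : obs X c Ch W) (h : V ⊆ W) :
    Rej Ch V ⊆ Rej Ch W ∧ (Ch V).card ≤ (Ch W).card := by
  have := (oreach_union hg hCh hV hW).1
  rw [Finset.union_eq_right.mpr h] at this
  exact mono_reach hg hV this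

/-- Iterated IRC. -/
theorem irc (hCh : IsChoice X c Ch) {A B : Finset (C × S × T)} (hAB : A ⊆ B)
    (hB : B ⊆ Xc X c) (h : Ch B ⊆ A) : Ch A = Ch B := by
  have key : ∀ N : Finset (C × S × T), A ∪ N ⊆ Xc X c → Ch (A ∪ N) ⊆ A →
      Ch A = Ch (A ∪ N) := by
    intro N
    induction N using Finset.induction_on with
    | empty => intro _ _; simp
    | insert x N hx ih =>
      intro h1 h2
      rw [Finset.union_insert] at h1 h2 ⊢
      by_cases hxm : x ∈ A ∪ N
      · rw [Finset.insert_eq_of_mem hxm] at h1 h2 ⊢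
        exact ih h1 h2
      · have h3 : A ∪ N ⊆ Xc X c := (Finset.subset_insert _ _).trans h1
        have h4 := hCh.2.2 (A ∪ N) h3 x (h1 (Finset.mem_insert_self _ _)) hxm
          (fun hh => hxm (Finset.mem_union_left _ (h2 hh)))
        rw [← h4] at h2 ⊢
        exact ih h3 h2
  have := key B
  rw [Finset.union_eq_right.mpr hAB] at this
  exact this hB h

theorem vee_spec (hg : good X c Ch) (hCh : IsChoice X c Ch) (Y : Finset (C × S × T)) :
    vee X c Ch Y ⊆ Uset X c Y ∧ obs X c Ch (vee X c Ch Y) ∧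
      ∀ V, obs X c Ch V → V ⊆ Uset X c Y → V ⊆ vee X c Ch Y := by
  have hex : ∃ V, MaxObsSubset X c Ch (Uset X c Y) V := by
    have hne : ((Uset X c Y).powerset.filter fun V => obs X c Ch V).Nonempty :=
      ⟨∅, by simp only [Finset.mem_filter, Finset.mem_powerset]
             exact ⟨Finset.empty_subset _, Relation.ReflTransGen.refl⟩⟩
    obtain ⟨V, hV, hmax⟩ := Finset.exists_max_image _ (fun V => V.card) hne
    simp only [Finset.mem_filter, Finset.mem_powerset] at hV hmax
    refine ⟨V, hV.1, (obsSet_iff hCh V).mpr hV.2, ?_⟩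
    intro Y' h1 h2 h3
    exact (Finset.eq_of_subset_of_card_le h2
      (hmax Y' ⟨h3, (obsSet_iff hCh Y').mp h1⟩)).symm
  have hm : MaxObsSubset X c Ch (Uset X c Y) (vee X c Ch Y) := by
    unfold vee
    rw [dif_pos hex]
    exact hex.choose_spec
  obtain ⟨h1, h2, h3⟩ := hm
  have h2' := (obsSet_iff hCh _).mp h2
  refine ⟨h1, h2', ?_⟩
  intro V hV hVU
  have hu : obs X c Ch (V ∪ vee X c Ch Y) :=
    Relation.ReflTransGen.trans hV (oreach_union hg hCh hV h2').1
  have := h3 _ ((obsSet_iff hCh _).mpr hu) Finset.subset_union_right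
    (Finset.union_subset hVU h1)
  rw [← this]
  exact Finset.subset_union_left

theorem mem_Uset {Y : Finset (C × S × T)} {x : C × S × T} : x ∈ Uset X c Y ↔
    x ∈ Xc X c ∧ ∃ y ∈ Y, x.2.1 = y.2.1 ∧ (y.2.2 < x.2.2 ∨ x = y) := by
  simp [Uset]

theorem Uset_mono {Y Y' : Finset (C × S × T)} (h : Y ⊆ Y') : Uset X c Y ⊆ Uset X c Y' := by
  intro x hx
  rw [mem_Uset] at hx ⊢
  obtain ⟨h1, y, hy, h2⟩ := hx
  exact ⟨h1, y, h hy, h2⟩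

theorem Uset_up {Y : Finset (C × S × T)} {x y : C × S × T} (hx : x ∈ Uset X c Y)
    (hy : y ∈ Xc X c) (hs : y.2.1 = x.2.1) (ht : x.2.2 < y.2.2) : y ∈ Uset X c Y := by
  rw [mem_Uset] at hx ⊢
  obtain ⟨h1, z, hz, h2, h3⟩ := hx
  refine ⟨hy, z, hz, hs.trans h2, Or.inl ?_⟩
  rcases h3 with h3 | h3
  · exact h3.trans ht
  · rw [← h3]; exact ht

theorem vee_mono (hg : good X c Ch) (hCh : IsChoice X c Ch) {Y Y' : Finset (C × S × T)}
    (h : Y ⊆ Y') : vee X c Ch Y ⊆ vee X c Ch Y' := by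
  obtain ⟨h1, h2, _⟩ := vee_spec hg hCh Y
  exact (vee_spec hg hCh Y').2.2 _ h2 (h1.trans (Uset_mono h))

/-- Saturation: all contracts of an unchosen student are used. -/
theorem saturated (hg : good X c Ch) (hCh : IsChoice X c Ch) {Y : Finset (C × S × T)}
    {s : S} (hs : ∀ y ∈ Ch (vee X c Ch Y), y.2.1 ≠ s) :
    ∀ x ∈ Uset X c Y, x.2.1 = s → x ∈ vee X c Ch Y := by
  obtain ⟨h1, h2, h3⟩ := vee_spec hg hCh Y
  by_contra! hcon
  obtain ⟨x0, hx0, hx0s, hx0V⟩ := hcon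
  have hne : ((Uset X c Y).filter fun x => x.2.1 = s ∧ x ∉ vee X c Ch Y).Nonempty :=
    ⟨x0, by simp [hx0, hx0s, hx0V]⟩
  obtain ⟨x, hx, hmax⟩ := Finset.exists_max_image _ (fun x => x.2.2) hne
  simp only [Finset.mem_filter] at hx hmax
  obtain ⟨hxU, hxs, hxV⟩ := hx
  have hxc := (mem_Uset.mp hxU).1
  have hstep : ostep X c Ch (vee X c Ch Y) (insert x (vee X c Ch Y)) := by
    refine ⟨x, hxc, hxV, ?_, ?_, rfl⟩
    · intro y hy hys hyt
      by_contra hyV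
      have := hmax y ⟨Uset_up hxU hy hys hyt, hys.trans hxs, hyV⟩
      exact absurd hyt (not_lt.mpr this)
    · rw [hxs]; exact hs
  have := h3 _ (Relation.ReflTransGen.tail h2 hstep) (Finset.insert_subset hxU h1)
  exact hxV (this (Finset.mem_insert_self _ _))

theorem unchosen_mono (hg : good X c Ch) (hCh : IsChoice X c Ch)
    {Y Y' : Finset (C × S × T)} (h : Y ⊆ Y') {s : S}
    (hU : ∀ x ∈ Uset X c Y', x.2.1 = s → x ∈ Uset X c Y)
    (hs : ∀ y ∈ Ch (vee X c Ch Y), y.2.1 ≠ s) : ∀ y ∈ Ch (vee X c Ch Y'), y.2.1 ≠ s := by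
  intro y hy hys
  obtain ⟨h1, h2, _⟩ := vee_spec hg hCh Y
  obtain ⟨h1', h2', _⟩ := vee_spec hg hCh Y'
  have hyV' := hCh.1 _ (obs_sub h2') hy
  have hyV := saturated hg hCh hs y (hU y (h1' hyV') hys) hys
  have hr : y ∈ Rej Ch (vee X c Ch Y) := by
    unfold Rej
    exact Finset.mem_sdiff.mpr ⟨hyV, fun h => hs y h hys⟩
  have := (mono_obs hg hCh h2 h2' (vee_mono hg hCh h)).1 hr
  unfold Rej at this
  exact (Finset.mem_sdiff.mp this).2 hy

theorem mem_Ymin {Y : Finset (C × S × T)} {x : C × S × T} : x ∈ Ymin Y ↔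
    x ∈ Y ∧ ∀ y' ∈ Y, y'.2.1 = x.2.1 → ¬ y'.2.2 < x.2.2 := by
  simp [Ymin]

theorem Ymin_alloc {Y : Finset (C × S × T)} (hY : Y ⊆ Xc X c) : IsAlloc (Ymin Y) := by
  intro x hx y hy hs
  rw [mem_Ymin] at hx hy
  refine eq_of_term (hY hx.1) (hY hy.1) hs (le_antisymm ?_ ?_)
  · exact not_lt.mp (hx.2 y hy.1 hs.symm)
  · exact not_lt.mp (hy.2 x hx.1 hs)

theorem mem_virt {Y : Finset (C × S × T)} {x : C × S × T} : x ∈ virtualChoice X c Ch Y ↔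
    x ∈ Ymin Y ∧ ∃ y ∈ Ch (vee X c Ch Y), y.2.1 = x.2.1 := by
  simp only [virtualChoice, Finset.mem_filter, Finset.mem_image]

theorem exists_min {Y : Finset (C × S × T)} {y : C × S × T} (hy : y ∈ Y) :
    ∃ x ∈ Ymin Y, x.2.1 = y.2.1 := by
  have hne : (Y.filter fun x => x.2.1 = y.2.1).Nonempty := ⟨y, by simp [hy]⟩
  obtain ⟨x, hx, hmin⟩ := Finset.exists_min_image _ (fun x => x.2.2) hne
  simp only [Finset.mem_filter] at hx hmin
  refine ⟨x, mem_Ymin.mpr ⟨hx.1, ?_⟩, hx.2⟩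
  intro z hz hzs
  exact not_lt.mpr (hmin z ⟨hz, hzs.trans hx.2⟩)

theorem virt_image (hg : good X c Ch) (hCh : IsChoice X c Ch) (Y : Finset (C × S × T)) :
    (virtualChoice X c Ch Y).image (fun y => y.2.1) =
      (Ch (vee X c Ch Y)).image (fun y => y.2.1) := by
  obtain ⟨h1, h2, _⟩ := vee_spec hg hCh Y
  ext s
  simp only [Finset.mem_image]
  constructor
  · rintro ⟨x, hx, rfl⟩
    exact (mem_virt.mp hx).2
  · rintro ⟨y, hy, rfl⟩
    have := h1 (hCh.1 _ (obs_sub h2) hy)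
    obtain ⟨_, z, hz, hzs, _⟩ := mem_Uset.mp this
    obtain ⟨x, hx, hxs⟩ := exists_min hz
    exact ⟨x, mem_virt.mpr ⟨hx, y, hy, hzs.trans hxs.symm⟩, hxs.trans hzs.symm⟩

theorem alloc_card {Y : Finset (C × S × T)} (h : IsAlloc Y) :
    (Y.image (fun y => y.2.1)).card = Y.card :=
  Finset.card_image_of_injOn (fun x hx y hy hs => h x hx y hy hs)

theorem virt_alloc {Y : Finset (C × S × T)} (hY : Y ⊆ Xc X c) :
    IsAlloc (virtualChoice X c Ch Y) := by
  intro x hx y hy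
  exact Ymin_alloc hY x (mem_virt.mp hx).1 y (mem_virt.mp hy).1

theorem virt_card (hg : good X c Ch) (hCh : IsChoice X c Ch) {Y : Finset (C × S × T)}
    (hY : Y ⊆ Xc X c) : (virtualChoice X c Ch Y).card = (Ch (vee X c Ch Y)).card := by
  rw [← alloc_card (virt_alloc hY), virt_image hg hCh,
    alloc_card (hCh.2.1 _ (obs_sub (vee_spec hg hCh Y).2.1))]

theorem vee_congr {Y Y' : Finset (C × S × T)} (h : Uset X c Y = Uset X c Y') :
    vee X c Ch Y = vee X c Ch Y' := by
  unfold vee; rw [h]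

theorem Uset_insert_eq {Y : Finset (C × S × T)} {z y : C × S × T} (hy : y ∈ Y)
    (hs : y.2.1 = z.2.1) (ht : y.2.2 < z.2.2) : Uset X c (insert z Y) = Uset X c Y := by
  apply Finset.Subset.antisymm _ (Uset_mono (Finset.subset_insert _ _))
  intro x hx
  rw [mem_Uset] at hx ⊢
  obtain ⟨h1, w, hw, h2, h3⟩ := hx
  rcases Finset.mem_insert.mp hw with h | h
  · subst h
    refine ⟨h1, y, hy, h2.trans hs.symm, Or.inl ?_⟩
    rcases h3 with h3 | h3
    · exact ht.trans h3
    · rw [h3]; exact ht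
  · exact ⟨h1, w, h, h2, h3⟩

theorem Uset_insert_of_ne {Y : Finset (C × S × T)} {z x : C × S × T}
    (hx : x ∈ Uset X c (insert z Y)) (hs : x.2.1 ≠ z.2.1) : x ∈ Uset X c Y := by
  rw [mem_Uset] at hx ⊢
  obtain ⟨h1, w, hw, h2, h3⟩ := hx
  rcases Finset.mem_insert.mp hw with h | h
  · subst h; exact absurd h2 hs
  · exact ⟨h1, w, h, h2, h3⟩

theorem virt_isChoice (hg : good X c Ch) (hCh : IsChoice X c Ch) :
    IsChoice X c (virtualChoice X c Ch) := by
  refine ⟨?_, fun Y hY => virt_alloc hY, ?_⟩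
  · intro Y _ x hx
    exact (mem_Ymin.mp (mem_virt.mp hx).1).1
  · intro Y hY x hx hxY hxn
    have hsub : insert x Y ⊆ Xc X c := Finset.insert_subset hx hY
    by_cases hmin : x ∈ Ymin (insert x Y)
    · have hxs : ∀ y ∈ Ch (vee X c Ch (insert x Y)), y.2.1 ≠ x.2.1 := by
        intro y hy hys
        exact hxn (mem_virt.mpr ⟨hmin, y, hy, hys⟩)
      have hV := (vee_spec hg hCh Y).2.1
      have hV' := (vee_spec hg hCh (insert x Y)).2.1
      have him : (Ch (vee X c Ch (insert x Y))).image (fun y => y.2.1) =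
          (Ch (vee X c Ch Y)).image (fun y => y.2.1) := by
        apply Finset.eq_of_subset_of_card_le
        · intro s hs
          rw [Finset.mem_image] at hs ⊢
          obtain ⟨y, hy, hys⟩ := hs
          by_contra hno
          push Not at hno
          refine unchosen_mono hg hCh (Finset.subset_insert x Y) ?_ hno y hy hys
          intro z hz hzs
          exact Uset_insert_of_ne hz (by rw [hzs, ← hys]; exact hxs y hy)
        · rw [alloc_card (hCh.2.1 _ (obs_sub hV)), alloc_card (hCh.2.1 _ (obs_sub hV'))]
          exact (mono_obs hg hCh hV hV' (vee_mono hg hCh (Finset.subset_insert x Y))).2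
      have hxnot : x.2.1 ∉ (Ch (vee X c Ch Y)).image (fun y => y.2.1) := by
        rw [← him, Finset.mem_image]
        rintro ⟨y, hy, hys⟩
        exact hxs y hy hys
      ext z
      unfold virtualChoice
      rw [Finset.mem_filter, Finset.mem_filter, him]
      refine and_congr_left fun hz => ?_
      have hzx : z.2.1 ≠ x.2.1 := fun h => hxnot (h ▸ hz)
      rw [mem_Ymin, mem_Ymin, Finset.mem_insert]
      constructor
      · rintro ⟨h1, h2⟩
        refine ⟨Or.inr h1, fun y hy hys => ?_⟩
        rcases Finset.mem_insert.mp hy with h | h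
        · subst h; exact absurd hys.symm hzx
        · exact h2 y h hys
      · rintro ⟨h1, h2⟩
        refine ⟨?_, fun y hy hys => h2 y (Finset.mem_insert_of_mem hy) hys⟩
        rcases h1 with h | h
        · exact absurd (congrArg (fun y => y.2.1) h) hzx
        · exact h
    · have : ∃ y ∈ Y, y.2.1 = x.2.1 ∧ y.2.2 < x.2.2 := by
        by_contra hno
        push Not at hno
        apply hmin
        rw [mem_Ymin]
        refine ⟨Finset.mem_insert_self _ _, fun y hy hys => ?_⟩
        rcases Finset.mem_insert.mp hy with h | h
        · subst h; exact lt_irrefl _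
        · exact not_lt.mpr (hno y h hys)
      obtain ⟨y, hy, hys, hyt⟩ := this
      have hv : vee X c Ch (insert x Y) = vee X c Ch Y :=
        vee_congr (Uset_insert_eq hy hys hyt)
      ext z
      rw [mem_virt, mem_virt, hv]
      refine and_congr_left fun _ => ?_
      rw [mem_Ymin, mem_Ymin, Finset.mem_insert]
      constructor
      · rintro ⟨h1, h2⟩
        refine ⟨Or.inr h1, fun w hw hws => ?_⟩
        rcases Finset.mem_insert.mp hw with h | h
        · subst h
          have := h2 y hy (hys.trans hws)
          exact fun hlt => this (hyt.trans hlt)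
        · exact h2 w h hws
      · rintro ⟨h1, h2⟩
        refine ⟨?_, fun w hw hws => h2 w (Finset.mem_insert_of_mem hw) hws⟩
        rcases h1 with h | h
        · subst h
          exact absurd hyt (h2 y (Finset.mem_insert_of_mem hy) hys)
        · exact h

theorem virt_subst (hg : good X c Ch) (hCh : IsChoice X c Ch) :
    Substitutes X c (virtualChoice X c Ch) := by
  intro Y hY x hx z hz hxY hzY hmem
  rw [mem_virt] at hmem ⊢
  obtain ⟨hmin, y, hy, hys⟩ := hmem
  have hmin' : x ∈ Ymin (insert x Y) := by
    rw [mem_Ymin] at hmin ⊢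
    exact ⟨Finset.mem_insert_self _ _,
      fun w hw => hmin.2 w (Finset.mem_insert_of_mem hw)⟩
  refine ⟨hmin', ?_⟩
  by_cases hs : x.2.1 = z.2.1
  · have hle : x.2.2 ≤ z.2.2 :=
      not_lt.mp ((mem_Ymin.mp hmin).2 z (Finset.mem_insert_self _ _) hs.symm)
    have hv : vee X c Ch (insert z (insert x Y)) = vee X c Ch (insert x Y) := by
      rcases hle.lt_or_eq with h | h
      · exact vee_congr (Uset_insert_eq (Finset.mem_insert_self _ _) hs h)
      · have : x = z := eq_of_term hx hz hs h
        subst this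
        rw [Finset.insert_eq_of_mem (Finset.mem_insert_self _ _)]
    exact ⟨y, hv ▸ hy, hys⟩
  · by_contra hno
    push Not at hno
    refine unchosen_mono hg hCh (Finset.subset_insert z (insert x Y)) ?_ hno y hy hys
    intro w hw hws
    exact Uset_insert_of_ne hw (by rw [hws]; exact hs)

theorem virt_lad (hg : good X c Ch) (hCh : IsChoice X c Ch) :
    LAD X c (virtualChoice X c Ch) := by
  intro Z Y hZY hY
  rw [virt_card hg hCh hY, virt_card hg hCh (hZY.trans hY)]
  exact (mono_obs hg hCh (vee_spec hg hCh Z).2.1 (vee_spec hg hCh Y).2.1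
    (vee_mono hg hCh hZY)).2

theorem virt_mono : MonotoneCh X c (virtualChoice X c Ch) := by
  intro Y _ x hx
  exact (mem_virt.mp hx).1

/-- Adding several contracts, each of which is observable. -/
theorem oreach_many (hg : good X c Ch) (hCh : IsChoice X c Ch) {A : Finset (C × S × T)}
    (hA : obs X c Ch A) (N : Finset (C × S × T))
    (hN : ∀ x ∈ N, x ∈ A ∨ ostep X c Ch A (insert x A)) : oreach X c Ch A (A ∪ N) := by
  induction N using Finset.induction_on with
  | empty => rw [Finset.union_empty]; exact Relation.ReflTransGen.refl
  | insert x N _ ih =>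
    have h1 := ih (fun y hy => hN y (Finset.mem_insert_of_mem hy))
    rw [Finset.union_insert]
    by_cases hxA : x ∈ A
    · rw [Finset.insert_eq_of_mem (Finset.mem_union_left _ hxA)]; exact h1
    rcases hN x (Finset.mem_insert_self _ _) with h | h
    · exact absurd h hxA
    rcases (oreach_insert hg hCh hA h1 h hxA).2 with h2 | h2
    · rw [Finset.insert_eq_of_mem h2]; exact h1
    · exact Relation.ReflTransGen.tail h1 h2

variable {K : C → Finset (C × S × T) → Finset (C × S × T)} {u : S → C × S × T → ℤ}

/-- Contracts of `Y` naming college `c`. -/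
def atc (c : C) (Y : Finset (C × S × T)) : Finset (C × S × T) := Y.filter fun x => x.1 = c

theorem mem_atc {Y : Finset (C × S × T)} {x : C × S × T} :
    x ∈ atc c Y ↔ x ∈ Y ∧ x.1 = c := by
  simp [atc]

/-- The invariant of the deferred acceptance algorithm. -/
def Inv (X : Finset (C × S × T)) (K : C → Finset (C × S × T) → Finset (C × S × T))
    (u : S → C × S × T → ℤ) (D : Finset (C × S × T)) : Prop :=
  D ⊆ X ∧ ∀ c, ∃ B, obs X c (K c) B ∧ atc c D = Rej (K c) B ∧ B \ D ⊆ proposals X u D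

theorem mem_prop {D : Finset (C × S × T)} {x : C × S × T} : x ∈ proposals X u D ↔
    (x ∈ X ∧ x ∉ D) ∧ 0 < u x.2.1 x ∧
      ∀ y ∈ X, y ∉ D → y.2.1 = x.2.1 → u x.2.1 y ≤ u x.2.1 x := by
  simp only [proposals, Finset.mem_filter, Finset.mem_sdiff, and_imp]

theorem prop_alloc (hu : ∀ s, IsPref X s (u s)) (D : Finset (C × S × T)) :
    IsAlloc (proposals X u D) := by
  intro x hx y hy hs
  rw [mem_prop] at hx hy
  by_contra hne
  have h1 := hx.2.2 y hy.1.1 hy.1.2 hs.symm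
  have h2 := hy.2.2 x hx.1.1 hx.1.2 hs
  rw [← hs] at h2
  exact (hu x.2.1).2.1 x hx.1.1 y hy.1.1 rfl hs.symm hne (le_antisymm h2 h1)

theorem prop_up (hu : ∀ s, IsPref X s (u s)) {D : Finset (C × S × T)} {x y : C × S × T}
    (hx : x ∈ proposals X u D) (hy : y ∈ X) (hs : y.2.1 = x.2.1) (ht : x.2.2 < y.2.2) :
    y ∈ D := by
  rw [mem_prop] at hx
  by_contra hyD
  have h1 := hx.2.2 y hy hyD hs
  have h2 := (hu x.2.1).2.2 y hy x hx.1.1 hs rfl ht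
  omega

theorem inv_facts (hK : ∀ c, IsChoice X c (K c)) (hg : ∀ c, good X c (K c))
    (hu : ∀ s, IsPref X s (u s)) {D : Finset (C × S × T)} (hD : Inv X K u D) (c : C) :
    obs X c (K c) (atc c (D ∪ proposals X u D)) ∧
    atc c D ⊆ Rej (K c) (atc c (D ∪ proposals X u D)) ∧
    K c (atc c (D ∪ proposals X u D)) ⊆ atc c (proposals X u D) ∧
    K c (atc c (proposals X u D)) = K c (atc c (D ∪ proposals X u D)) := by
  obtain ⟨hDX, hD⟩ := hD
  obtain ⟨B, hB, hDB, hBP⟩ := hD c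
  have hBc := obs_sub hB
  have hA : atc c (D ∪ proposals X u D) = B ∪ atc c (proposals X u D) := by
    ext x
    rw [mem_atc, Finset.mem_union, Finset.mem_union, mem_atc]
    constructor
    · rintro ⟨h | h, hc⟩
      · left
        have : x ∈ Rej (K c) B := hDB ▸ mem_atc.mpr ⟨h, hc⟩
        exact (Finset.mem_sdiff.mp this).1
      · exact Or.inr ⟨h, hc⟩
    · rintro (h | h)
      · refine ⟨?_, (mem_Xc.mp (hBc h)).2⟩
        by_cases hx : x ∈ D
        · exact Or.inl hx
        · exact Or.inr (hBP (Finset.mem_sdiff.mpr ⟨h, hx⟩))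
      · exact ⟨Or.inr h.1, h.2⟩
  have hreach : oreach X c (K c) B (atc c (D ∪ proposals X u D)) := by
    rw [hA]
    apply oreach_many (hg c) (hK c) hB
    intro x hx
    obtain ⟨hxP, hxc⟩ := mem_atc.mp hx
    by_cases hxB : x ∈ B
    · exact Or.inl hxB
    right
    refine ⟨x, mem_Xc.mpr ⟨(mem_prop.mp hxP).1.1, hxc⟩, hxB, ?_, ?_, rfl⟩
    · intro y hy hys hyt
      have hyX := mem_Xc.mp hy
      have hyD := prop_up hu hxP hyX.1 hys hyt
      have : y ∈ Rej (K c) B := hDB ▸ mem_atc.mpr ⟨hyD, hyX.2⟩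
      exact (Finset.mem_sdiff.mp this).1
    · intro y hy hys
      have hyB := (hK c).1 _ hBc hy
      have hyD : y ∉ D := by
        intro h
        have : y ∈ Rej (K c) B := hDB ▸ mem_atc.mpr ⟨h, (mem_Xc.mp (hBc hyB)).2⟩
        exact (Finset.mem_sdiff.mp this).2 hy
      have hyP := hBP (Finset.mem_sdiff.mpr ⟨hyB, hyD⟩)
      have := prop_alloc hu D y hyP x hxP hys
      exact hxB (this ▸ hyB)
  have hobs : obs X c (K c) (atc c (D ∪ proposals X u D)) :=
    Relation.ReflTransGen.trans hB hreach
  have hrej : atc c D ⊆ Rej (K c) (atc c (D ∪ proposals X u D)) := by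
    rw [hDB]; exact (mono_reach (hg c) hB hreach).1
  have hsub : K c (atc c (D ∪ proposals X u D)) ⊆ atc c (proposals X u D) := by
    intro y hy
    have hyA := (hK c).1 _ (obs_sub hobs) hy
    obtain ⟨h1, h2⟩ := mem_atc.mp hyA
    refine mem_atc.mpr ⟨?_, h2⟩
    rcases Finset.mem_union.mp h1 with h | h
    · exact absurd hy (Finset.mem_sdiff.mp (hrej (mem_atc.mpr ⟨h, h2⟩))).2
    · exact h
  refine ⟨hobs, hrej, hsub, irc (hK c) ?_ (obs_sub hobs) hsub⟩
  intro y hy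
  rw [mem_atc] at hy ⊢
  exact ⟨Finset.mem_union_right _ hy.1, hy.2⟩

theorem mem_held {P : Finset (C × S × T)} {x : C × S × T} :
    x ∈ held K P ↔ x ∈ P ∧ x ∈ K x.1 (atc x.1 P) := by
  simp only [held, Finset.mem_filter, atc]

theorem mem_step {D : Finset (C × S × T)} {x : C × S × T} : x ∈ step X K u D ↔
    x ∈ D ∨ (x ∈ proposals X u D ∧ x ∉ K x.1 (atc x.1 (proposals X u D))) := by
  simp only [step, Finset.mem_union, Finset.mem_sdiff, mem_held]
  tauto

theorem inv_step (hK : ∀ c, IsChoice X c (K c)) (hg : ∀ c, good X c (K c))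
    (hu : ∀ s, IsPref X s (u s)) {D : Finset (C × S × T)} (hD : Inv X K u D) :
    Inv X K u (step X K u D) := by
  refine ⟨?_, fun c => ?_⟩
  · intro x hx
    rcases mem_step.mp hx with h | h
    · exact hD.1 h
    · exact (mem_prop.mp h.1).1.1
  obtain ⟨h1, h2, h3, h4⟩ := inv_facts hK hg hu hD c
  refine ⟨_, h1, ?_, ?_⟩
  · ext x
    rw [mem_atc, mem_step]
    unfold Rej
    rw [Finset.mem_sdiff, ← h4, mem_atc, Finset.mem_union]
    constructor
    · rintro ⟨h | h, rfl⟩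
      · refine ⟨⟨Or.inl h, rfl⟩, ?_⟩
        rw [h4]
        exact (Finset.mem_sdiff.mp (h2 (mem_atc.mpr ⟨h, rfl⟩))).2
      · exact ⟨⟨Or.inr h.1, rfl⟩, h.2⟩
    · rintro ⟨⟨h | h, rfl⟩, hn⟩
      · exact ⟨Or.inl h, rfl⟩
      · exact ⟨Or.inr ⟨h, hn⟩, rfl⟩
  · intro x hx
    obtain ⟨hxA, hxn⟩ := Finset.mem_sdiff.mp hx
    obtain ⟨hxA, _⟩ := mem_atc.mp hxA
    have hxD : x ∉ D := fun h => hxn (mem_step.mpr (Or.inl h))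
    have hxP : x ∈ proposals X u D := by
      rcases Finset.mem_union.mp hxA with h | h
      · exact absurd h hxD
      · exact h
    have := mem_prop.mp hxP
    exact mem_prop.mpr ⟨⟨this.1.1, hxn⟩, this.2.1,
      fun y hy hyn => this.2.2 y hy (fun h => hyn (mem_step.mpr (Or.inl h)))⟩

theorem inv_empty (hK : ∀ c, IsChoice X c (K c)) : Inv X K u ∅ := by
  refine ⟨Finset.empty_subset _, fun c => ⟨∅, Relation.ReflTransGen.refl, ?_, ?_⟩⟩
  · simp [atc, Rej]
  · simp

theorem inv_iter (hK : ∀ c, IsChoice X c (K c)) (hg : ∀ c, good X c (K c))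
    (hu : ∀ s, IsPref X s (u s)) (n : ℕ) : Inv X K u ((step X K u)^[n] ∅) := by
  induction n with
  | zero => exact inv_empty hK
  | succ n ih => rw [Function.iterate_succ_apply']; exact inv_step hK hg hu ih

theorem fixed (hK : ∀ c, IsChoice X c (K c)) (hg : ∀ c, good X c (K c))
    (hu : ∀ s, IsPref X s (u s)) :
    step X K u ((step X K u)^[X.card + 1] ∅) = (step X K u)^[X.card + 1] ∅ := by
  have key : ∀ n, step X K u ((step X K u)^[n] ∅) = (step X K u)^[n] ∅ ∨
      n ≤ ((step X K u)^[n] ∅).card := by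
    intro n
    induction n with
    | zero => right; exact Nat.zero_le _
    | succ n ih =>
      by_cases h : step X K u ((step X K u)^[n] ∅) = (step X K u)^[n] ∅
      · left; rw [Function.iterate_succ_apply', h, h]
      · right
        have hc := ih.resolve_left h
        rw [Function.iterate_succ_apply']
        have hss : (step X K u)^[n] ∅ ⊂ step X K u ((step X K u)^[n] ∅) := by
          refine Finset.ssubset_iff_subset_ne.mpr ⟨?_, fun he => h he.symm⟩
          intro x hx
          exact mem_step.mpr (Or.inl hx)
        have := Finset.card_lt_card hss
        omega
  rcases key (X.card + 1) with h | h
  · exact h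
  · have := Finset.card_le_card (inv_iter hK hg hu (X.card + 1)).1
    omega

theorem da_stable (hK : ∀ c, IsChoice X c (K c)) (hg : ∀ c, good X c (K c)) :
    DAStable X K := by
  intro u hu
  have hfix := fixed hK hg hu
  have hinv := inv_iter hK hg hu (X.card + 1)
  unfold DA
  generalize (step X K u)^[X.card + 1] ∅ = D at hfix hinv
  have hheld : held K (proposals X u D) = proposals X u D := by
    ext x
    rw [mem_held]
    refine ⟨fun h => h.1, fun h => ⟨h, ?_⟩⟩
    by_contra hn
    have : x ∈ step X K u D := mem_step.mpr (Or.inr ⟨h, hn⟩)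
    rw [hfix] at this
    exact (mem_prop.mp h).1.2 this
  rw [hheld]
  have hPX : ∀ x ∈ proposals X u D, x ∈ X := fun x hx => (mem_prop.mp hx).1.1
  have hpc : ∀ c, K c (atc c (proposals X u D)) = atc c (proposals X u D) := by
    intro c
    apply Finset.Subset.antisymm
    · apply (hK c).1
      intro x hx
      rw [mem_atc] at hx
      exact mem_Xc.mpr ⟨hPX x hx.1, hx.2⟩
    · intro x hx
      obtain ⟨hxp, rfl⟩ := mem_atc.mp hx
      rw [← hheld] at hxp
      exact (mem_held.mp hxp).2
  refine ⟨hPX, prop_alloc hu D, ⟨fun c => (hpc c).symm, fun y hy => (mem_prop.mp hy).2.1⟩, ?_⟩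
  rintro ⟨c, Z, hZX, hZa, hne, hZ, hut⟩
  obtain ⟨h1, h2, h3, h4⟩ := inv_facts hK hg hu hinv c
  have hsub : atc c (proposals X u D ∪ Z) ⊆ atc c (D ∪ proposals X u D) := by
    intro z hz
    obtain ⟨hz, hzc⟩ := mem_atc.mp hz
    refine mem_atc.mpr ⟨?_, hzc⟩
    rw [Finset.mem_union] at hz ⊢
    rcases hz with hz | hz
    · exact Or.inr hz
    by_cases hzD : z ∈ D
    · exact Or.inl hzD
    right
    have hzu := hut z (Finset.mem_filter.mpr ⟨hz, hzc⟩)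
    have hzX := hZX hz
    have hz0 := (hu z.2.1).1 z hzX rfl
    rcases lt_or_gt_of_ne hz0 with hneg | hpos
    · exfalso
      have : 0 ≤ util (u z.2.1) z.2.1 (proposals X u D) := by
        unfold util
        apply Finset.sum_nonneg
        intro y hy
        rw [Finset.mem_filter] at hy
        have := (mem_prop.mp hy.1).2.1
        rw [hy.2] at this
        exact this.le
      omega
    · have hnon : ((X \ D).filter fun y => y.2.1 = z.2.1).Nonempty :=
        ⟨z, by simp [hzX, hzD]⟩
      obtain ⟨y, hy, hmax⟩ := Finset.exists_max_image _ (fun y => u z.2.1 y) hnon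
      simp only [Finset.mem_filter, Finset.mem_sdiff] at hy hmax
      have hzy := hmax z ⟨⟨hzX, hzD⟩, rfl⟩
      have hyP : y ∈ proposals X u D := by
        rw [mem_prop, hy.2]
        exact ⟨hy.1, by omega, fun w hw hwD hws => hmax w ⟨⟨hw, hwD⟩, hws⟩⟩
      have hfil : (proposals X u D).filter (fun x => x.2.1 = z.2.1) = {y} := by
        ext w
        rw [Finset.mem_filter, Finset.mem_singleton]
        constructor
        · rintro ⟨hw, hws⟩
          exact prop_alloc hu D w hw y hyP (hws.trans hy.2.symm)
        · rintro rfl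
          exact ⟨hyP, hy.2⟩
      unfold util at hzu
      rw [hfil, Finset.sum_singleton] at hzu
      have : z = y := by
        by_contra hn
        exact (hu z.2.1).2.1 z hzX y hy.1.1 rfl hy.2 hn (le_antisymm hzy hzu)
      rw [this]; exact hyP
  have hirc : K c (atc c (proposals X u D ∪ Z)) = K c (atc c (D ∪ proposals X u D)) := by
    refine irc (hK c) hsub (obs_sub h1) (h3.trans ?_)
    intro x hx
    rw [mem_atc] at hx ⊢
    exact ⟨Finset.mem_union_left _ hx.1, hx.2⟩
  apply hne
  rw [hZ]
  change K c (atc c (proposals X u D ∪ Z)) = atc c (proposals X u D)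
  rw [hirc, ← h4, hpc]

theorem virt_agree (hK : ∀ c, IsChoice X c (K c)) (hg : ∀ c, good X c (K c))
    (hu : ∀ s, IsPref X s (u s)) {D : Finset (C × S × T)} (hD : Inv X K u D) (c : C) :
    virtualChoice X c (K c) (atc c (proposals X u D)) = K c (atc c (proposals X u D)) := by
  obtain ⟨h1, h2, h3, h4⟩ := inv_facts hK hg hu hD c
  have hAc := obs_sub h1
  have hPA : atc c (proposals X u D) ⊆ atc c (D ∪ proposals X u D) := by
    intro y hy
    rw [mem_atc] at hy ⊢
    exact ⟨Finset.mem_union_right _ hy.1, hy.2⟩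
  -- observable sets are upward closed
  have hclosed : ∀ V, obs X c (K c) V → ∀ x ∈ V, ∀ y ∈ Xc X c, y.2.1 = x.2.1 →
      x.2.2 < y.2.2 → y ∈ V := by
    intro V hV
    induction hV with
    | refl => intro x hx; simp at hx
    | tail _ h ih =>
      obtain ⟨w, hw, hwV, hup, hst, rfl⟩ := h
      intro x hx y hy hys hyt
      rcases Finset.mem_insert.mp hx with h | h
      · subst h; exact Finset.mem_insert_of_mem (hup y hy hys hyt)
      · exact Finset.mem_insert_of_mem (ih x h y hy hys hyt)
  have hU : Uset X c (atc c (D ∪ proposals X u D)) = atc c (D ∪ proposals X u D) := by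
    ext x
    rw [mem_Uset]
    constructor
    · rintro ⟨hx, y, hy, hs, h | h⟩
      · exact hclosed _ h1 y hy x hx hs h
      · rw [h]; exact hy
    · intro hx
      exact ⟨hAc hx, x, hx, rfl, Or.inr rfl⟩
  have hv : vee X c (K c) (atc c (D ∪ proposals X u D)) = atc c (D ∪ proposals X u D) := by
    obtain ⟨a, b, d⟩ := vee_spec (hg c) (hK c) (atc c (D ∪ proposals X u D))
    rw [hU] at a d
    exact Finset.Subset.antisymm a (d _ h1 (Finset.Subset.refl _))
  -- currently proposed contracts are minimal
  have hmin : ∀ x ∈ atc c (proposals X u D), x ∈ Ymin (atc c (D ∪ proposals X u D)) := by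
    intro x hx
    rw [mem_Ymin]
    refine ⟨hPA hx, fun y hy hys hyt => ?_⟩
    obtain ⟨hxP, hxc⟩ := mem_atc.mp hx
    obtain ⟨hyA, hyc⟩ := mem_atc.mp hy
    have hxD := (mem_prop.mp hxP).1.2
    rcases Finset.mem_union.mp hyA with h | h
    · obtain ⟨B, hB, hDB, hBP⟩ := hD.2 c
      have hyR : y ∈ Rej (K c) B := hDB ▸ mem_atc.mpr ⟨h, hyc⟩
      have hyB := (Finset.mem_sdiff.mp hyR).1
      have hxB := hclosed B hB y hyB x (hAc (hPA hx)) hys.symm hyt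
      -- track the time at which `y` was added
      have haux : ∀ V, obs X c (K c) V → y ∈ V → x ∈ Rej (K c) V := by
        intro V hV
        induction hV with
        | refl => intro hx; simp at hx
        | @tail V W hV hs ih =>
          intro hyW
          have hR := (hg c V W hV hs).1
          obtain ⟨w, hw, hwV, hup, hst, rfl⟩ := hs
          rcases Finset.mem_insert.mp hyW with h | h
          · subst h
            refine hR (Finset.mem_sdiff.mpr ⟨hup x (hAc (hPA hx)) hys.symm hyt, ?_⟩)
            exact fun h => hst x h hys.symm
          · exact hR (ih h)
      have := haux B hB hyB
      rw [← hDB] at this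
      exact hxD (mem_atc.mp this).1
    · have := prop_alloc hu D y h x hxP hys
      rw [this] at hyt
      exact lt_irrefl _ hyt
  have hVA : virtualChoice X c (K c) (atc c (D ∪ proposals X u D)) =
      K c (atc c (D ∪ proposals X u D)) := by
    ext x
    rw [mem_virt, hv]
    constructor
    · rintro ⟨hx, y, hy, hys⟩
      have := Ymin_alloc hAc x hx y (hmin y (h3 hy)) hys.symm
      rw [this]; exact hy
    · intro hx
      exact ⟨hmin x (h3 hx), x, hx, rfl⟩
  rw [h4, ← hVA]
  refine irc (virt_isChoice (hg c) (hK c)) hPA hAc ?_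
  rw [hVA]; exact h3

theorem da_eq (hK : ∀ c, IsChoice X c (K c)) (hg : ∀ c, good X c (K c)) :
    DAeq X K (fun c => virtualChoice X c (K c)) := by
  intro u hu
  have hh : ∀ D, Inv X K u D → held (fun c => virtualChoice X c (K c)) (proposals X u D) =
      held K (proposals X u D) := by
    intro D hD
    ext x
    rw [mem_held, mem_held, virt_agree hK hg hu hD]
  have hit : ∀ n, (step X (fun c => virtualChoice X c (K c)) u)^[n] ∅ =
      (step X K u)^[n] ∅ := by
    intro n
    induction n with
    | zero => rfl
    | succ n ih =>
      rw [Function.iterate_succ_apply', Function.iterate_succ_apply', ih]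
      have hI := inv_iter hK hg hu n
      generalize (step X K u)^[n] ∅ = D at hI
      unfold step
      rw [hh _ hI]
  unfold DA
  rw [hit, hh _ (inv_iter hK hg hu _)]

end helpers

/-- if contracts are observable substitutes and the observable law
of aggregate demand holds for every college, then `Ch` is DA-stable and
DA-equivalent to the profile of virtual choice functions, which is a valid choice
profile under which contracts are substitutes, the law of aggregate demand holds,
and which is monotone in contract terms; the virtual choice function of a college
is by construction built from that college's choice function alone. -/
theorem statement_11 [Fintype C] [Fintype S] [Fintype T]
    (X : Finset (C × S × T)) (Ch : C → Finset (C × S × T) → Finset (C × S × T))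
    (hCh : ∀ c, IsChoice X c (Ch c))
    (hobs : ∀ c, ObsSub X c (Ch c))
    (hlad : ∀ c, ObsLAD X c (Ch c)) :
    DAStable X Ch ∧
    DAeq X Ch (fun c => virtualChoice X c (Ch c)) ∧
    (∀ c, IsChoice X c (virtualChoice X c (Ch c))) ∧
    (∀ c, Substitutes X c (virtualChoice X c (Ch c))) ∧
    (∀ c, LAD X c (virtualChoice X c (Ch c))) ∧
    (∀ c, MonotoneCh X c (virtualChoice X c (Ch c))) := by
  have hg : ∀ c, good X c (Ch c) := fun c => good_of (hobs c) (hlad c)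
  exact ⟨da_stable hCh hg, da_eq hCh hg, fun c => virt_isChoice (hg c) (hCh c),
    fun c => virt_subst (hg c) (hCh c), fun c => virt_lad (hg c) (hCh c), fun c => virt_mono⟩

end MWC
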